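/- Let k be a field of characteristic 0, p = 3 and n = 8. The Plücker quadratic form P_{{1,2,3},{4,5,6,7,8}} on ⋀^3 k^8 is not a k-linear combination of the quadratic forms P'_{A,B,C}, ranging over all choices of A = {α_1,α_2,α_3,α_4} ⊂ {1,…,8}, B a set of m 2-vectors in {1,…,8}^2 with 0 ≤ m ≤ 1, and C ⊂ {1,…,8} with |C| = 1−m. -/

import Mathlib

open ExteriorAlgebra

noncomputable section

variable (k : Type*) [Field k]

/-- The alternating map giving the coordinate `Π_idx` (antisymmetric in `idx`). -/
def coordA {n : ℕ} (q : ℕ) (idx : Fin q → Fin n) :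
    (Fin n → k) [⋀^Fin q]→ₗ[k] k :=
  (Matrix.detRowAlternating : (Fin q → k) [⋀^Fin q]→ₗ[k] k).compLinearMap
    (LinearMap.funLeft k k idx)

/-- The coordinate functional `Π_idx` on the exterior algebra. -/
def coordF {n : ℕ} (q : ℕ) (idx : Fin q → Fin n) :
    ExteriorAlgebra k (Fin n → k) →ₗ[k] k :=
  ExteriorAlgebra.liftAlternating
    (Function.update (fun i => (0 : (Fin n → k) [⋀^Fin i]→ₗ[k] k)) q (coordA k q idx))

/-- Decomposability of an element of the exterior algebra, in degree `q`. -/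
def IsDecomp {n : ℕ} (q : ℕ) (x : ExteriorAlgebra k (Fin n → k)) : Prop :=
  ∃ v : Fin q → (Fin n → k), x = ExteriorAlgebra.ιMulti k q v

/-- The dual isomorphism `δ` on the degree-`p` part, with values in degree `n-p`. -/
def dualAt (n p : ℕ) (ω : ExteriorAlgebra k (Fin n → k)) :
    ExteriorAlgebra k (Fin n → k) :=
  ∑ s : {s : Finset (Fin n) // s.card = p},
    coordF k p (fun a => (s.1.orderIsoOfFin s.2 a : Fin n)) ω •
      ExteriorAlgebra.ιMulti k (n - p)
        (fun a => Pi.single (((s.1ᶜ).orderIsoOfFin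
          (by rw [Finset.card_compl, s.2, Fintype.card_fin]) a : Fin n)) (1 : k))

/-- The index tuple `(α_i, α_j, β_1^{ε_1}, …, β_m^{ε_m}, γ_1, …, γ_c)`. -/
def tupleP {n : ℕ} (m c : ℕ) (α : Fin 4 → Fin n) (β : Fin m → Fin 2 → Fin n)
    (γ : Fin c → Fin n) (i j : Fin 4) (ε : Fin m → Fin 2) : Fin (2 + (m + c)) → Fin n :=
  Fin.append ![α i, α j] (Fin.append (fun l => β l (ε l)) γ)

/-- The functional `π_{ij} = Π_{α_i α_j β⃗_1 … β⃗_m γ_1 … γ_c}`. -/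
def piF {n : ℕ} (m c : ℕ) (α : Fin 4 → Fin n) (β : Fin m → Fin 2 → Fin n)
    (γ : Fin c → Fin n) (i j : Fin 4) :
    ExteriorAlgebra k (Fin n → k) →ₗ[k] k :=
  ∑ ε : Fin m → Fin 2, coordF k (2 + (m + c)) (tupleP m c α β γ i j ε)

/-- The rank 6 quadratic form `P'_{A,B,C}`. -/
def Pprime {n : ℕ} (m c : ℕ) (α : Fin 4 → Fin n) (β : Fin m → Fin 2 → Fin n)
    (γ : Fin c → Fin n) (ω : ExteriorAlgebra k (Fin n → k)) : k :=
  piF k m c α β γ 0 1 ω * piF k m c α β γ 2 3 ω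
    - piF k m c α β γ 0 2 ω * piF k m c α β γ 1 3 ω
    + piF k m c α β γ 0 3 ω * piF k m c α β γ 1 2 ω

/-- The ordering/distinctness conditions on the triple `(A,B,C)`. -/
def OrderedABC {n : ℕ} (m c : ℕ) (α : Fin 4 → Fin n) (β : Fin m → Fin 2 → Fin n)
    (γ : Fin c → Fin n) : Prop :=
  Function.Injective (Sum.elim α (Sum.elim (fun x : Fin m × Fin 2 => β x.1 x.2) γ)) ∧
    StrictMono α ∧ (∀ l, β l 0 < β l 1) ∧
    (∀ ν : Fin 2, StrictMono fun l => β l ν) ∧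
    (∀ l, β l 0 < α 0) ∧ (∀ l, β l 1 < α 2) ∧ StrictMono γ

/-- The set `S' = A ∪ B_1 ∪ C`. -/
def SP {n : ℕ} (m c : ℕ) (α : Fin 4 → Fin n) (β : Fin m → Fin 2 → Fin n)
    (γ : Fin c → Fin n) : Finset (Fin n) :=
  Finset.univ.image α ∪ Finset.univ.image (fun l => β l 1) ∪ Finset.univ.image γ

open Classical in
/-- The matrix of the map `X_{A,B,C} : k^n → k^{p+2}`. -/
def Xmat (p : ℕ) {n : ℕ} (m c : ℕ) (α : Fin 4 → Fin n) (β : Fin m → Fin 2 → Fin n)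
    (γ : Fin c → Fin n) : Matrix (Fin (p + 2)) (Fin n) k :=
  if h : (SP m c α β γ).card = p + 2 then
    fun j i =>
      (if i = ((SP m c α β γ).orderIsoOfFin h j : Fin n) then 1 else 0) +
        ∑ l : Fin m,
          if i = β l 0 ∧ β l 1 = ((SP m c α β γ).orderIsoOfFin h j : Fin n) then 1 else 0
  else 0

/-- The linear map `X_{A,B,C} : k^n → k^{p+2}`. -/
def XL (p : ℕ) {n : ℕ} (m c : ℕ) (α : Fin 4 → Fin n) (β : Fin m → Fin 2 → Fin n)
    (γ : Fin c → Fin n) : (Fin n → k) →ₗ[k] (Fin (p + 2) → k) :=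
  (Xmat k p m c α β γ).mulVecLin

open Classical in
/-- The matrix of the map `Z : k^{p+2} → k^4`. -/
def Zmat (p : ℕ) {n : ℕ} (m c : ℕ) (α : Fin 4 → Fin n) (β : Fin m → Fin 2 → Fin n)
    (γ : Fin c → Fin n) : Matrix (Fin 4) (Fin (p + 2)) k :=
  fun j i => if XL k p m c α β γ (Pi.single (α j) 1) = Pi.single i 1 then 1 else 0

/-- The linear map `Z : k^{p+2} → k^4`. -/
def ZL (p : ℕ) {n : ℕ} (m c : ℕ) (α : Fin 4 → Fin n) (β : Fin m → Fin 2 → Fin n)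
    (γ : Fin c → Fin n) : (Fin (p + 2) → k) →ₗ[k] (Fin 4 → k) :=
  (Zmat k p m c α β γ).mulVecLin

/-- The Grassmann cone preserving map `G_{A,B,C} = ⋀²Z ∘ δ ∘ ⋀^p X_{A,B,C}`. -/
def GABC (p : ℕ) {n : ℕ} (m c : ℕ) (α : Fin 4 → Fin n) (β : Fin m → Fin 2 → Fin n)
    (γ : Fin c → Fin n) (ω : ExteriorAlgebra k (Fin n → k)) :
    ExteriorAlgebra k (Fin 4 → k) :=
  ExteriorAlgebra.map (ZL k p m c α β γ)
    (dualAt k (p + 2) p (ExteriorAlgebra.map (XL k p m c α β γ) ω))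

/-- The general Plücker quadratic form `P_{A,B}` for index sequences
`a : Fin d → Fin n` and `b : Fin (e+1) → Fin n`. -/
def Pluecker {n : ℕ} (d e : ℕ) (a : Fin d → Fin n) (b : Fin (e + 1) → Fin n)
    (ω : ExteriorAlgebra k (Fin n → k)) : k :=
  ∑ i : Fin (e + 1), (-1 : k) ^ (i : ℕ) *
    (coordF k (d + 1) (Fin.snoc a (b i)) ω * coordF k e (fun j => b (i.succAbove j)) ω)


/-- The matrix whose column `y` is the indicator of the points `x` with `enc x = u y`. -/
def indicatorMatrix {ι α : Type*} [DecidableEq α] (enc u : ι → α) : Matrix ι ι k :=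
  Matrix.of fun x y => if enc x = u y then 1 else 0

/-- The pairing of two functionals on the exterior algebra obtained by antisymmetrizing their
product over the basis vectors `e_{enc x}`. -/
def altPairing {n : ℕ} (q : ℕ) (enc : Fin q ⊕ Fin q → Fin n)
    (f g : ExteriorAlgebra k (Fin n → k) →ₗ[k] k) : k :=
  ∑ σ : Equiv.Perm (Fin q ⊕ Fin q), ((Equiv.Perm.sign σ : ℤ) : k) *
    (f (ExteriorAlgebra.ιMulti k q fun a =>
        (Pi.single (enc (σ (Sum.inl a))) 1 : Fin n → k)) *
      g (ExteriorAlgebra.ιMulti k q fun a =>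
        (Pi.single (enc (σ (Sum.inr a))) 1 : Fin n → k)))

/-- The antisymmetrized polarization of a function on the exterior power. -/
def polarTrace {n : ℕ} (q : ℕ) (enc : Fin q ⊕ Fin q → Fin n) :
    (⋀[k]^q (Fin n → k) → k) →ₗ[k] k where
  toFun Q := ∑ σ : Equiv.Perm (Fin q ⊕ Fin q), ((Equiv.Perm.sign σ : ℤ) : k) *
    (Q (exteriorPower.ιMulti k q (fun a => (Pi.single (enc (σ (Sum.inl a))) 1 : Fin n → k)) +
        exteriorPower.ιMulti k q (fun a => (Pi.single (enc (σ (Sum.inr a))) 1 : Fin n → k))) -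
      Q (exteriorPower.ιMulti k q fun a => (Pi.single (enc (σ (Sum.inl a))) 1 : Fin n → k)) -
      Q (exteriorPower.ιMulti k q fun a => (Pi.single (enc (σ (Sum.inr a))) 1 : Fin n → k)))
  map_add' Q R := by
    rw [← Finset.sum_add_distrib]
    refine Finset.sum_congr rfl fun σ _ => ?_
    simp only [Pi.add_apply]
    ring
  map_smul' c Q := by
    rw [smul_eq_mul, Finset.mul_sum]
    refine Finset.sum_congr rfl fun σ _ => ?_
    simp only [Pi.smul_apply, smul_eq_mul, RingHom.id_apply]
    ring

section

variable {k}

lemma coordF_ιMulti {n q : ℕ} (idx : Fin q → Fin n) (v : Fin q → Fin n → k) :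
    coordF k q idx (ExteriorAlgebra.ιMulti k q v) =
      (Matrix.of fun a b => v a (idx b)).det := by
  rw [coordF, ExteriorAlgebra.liftAlternating_apply_ιMulti, Function.update_self]
  rfl

lemma coordF_ιMulti_single {n q : ℕ} (idx s : Fin q → Fin n) :
    coordF k q idx (ExteriorAlgebra.ιMulti k q fun a => Pi.single (s a) 1) =
      (indicatorMatrix k s idx).det := by
  rw [coordF_ιMulti]
  congr 1
  ext a b
  simp [indicatorMatrix, Pi.single_apply, eq_comm]

lemma polarTrace_mul {n q : ℕ} (enc : Fin q ⊕ Fin q → Fin n)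
    (f g : ExteriorAlgebra k (Fin n → k) →ₗ[k] k) :
    polarTrace k q enc (fun ω => f ω.val * g ω.val) =
      altPairing k q enc f g + altPairing k q enc g f := by
  simp only [polarTrace, altPairing, LinearMap.coe_mk, AddHom.coe_mk, ← Finset.sum_add_distrib]
  refine Finset.sum_congr rfl fun σ _ => ?_
  simp only [Submodule.coe_add, exteriorPower.ιMulti_apply_coe, map_add]
  ring

lemma altPairing_coordF {n q : ℕ} (enc : Fin q ⊕ Fin q → Fin n) (i j : Fin q → Fin n) :
    altPairing k q enc (coordF k q i) (coordF k q j) =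
      (q.factorial : k) ^ 2 * (indicatorMatrix k enc (Sum.elim i j)).det := by
  have key (τ₁ τ₂ : Equiv.Perm (Fin q)) :
      ∑ σ : Equiv.Perm (Fin q ⊕ Fin q), ((Equiv.Perm.sign σ : ℤ) : k) *
        ((((Equiv.Perm.sign τ₁ : ℤ) : k) *
            ∏ a, indicatorMatrix k (fun a => enc (σ (Sum.inl a))) i (τ₁ a) a) *
          (((Equiv.Perm.sign τ₂ : ℤ) : k) *
            ∏ a, indicatorMatrix k (fun a => enc (σ (Sum.inr a))) j (τ₂ a) a)) =
      (indicatorMatrix k enc (Sum.elim i j)).det := by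
    rw [Matrix.det_apply']
    refine Fintype.sum_equiv (Equiv.mulRight (Equiv.Perm.sumCongr τ₁ τ₂)) _ _ fun σ => ?_
    have hl (a : Fin q) : indicatorMatrix k (fun a => enc (σ (Sum.inl a))) i (τ₁ a) a =
        indicatorMatrix k enc (Sum.elim i j) (σ (Sum.inl (τ₁ a))) (Sum.inl a) := rfl
    have hr (a : Fin q) : indicatorMatrix k (fun a => enc (σ (Sum.inr a))) j (τ₂ a) a =
        indicatorMatrix k enc (Sum.elim i j) (σ (Sum.inr (τ₂ a))) (Sum.inr a) := rfl
    simp [hl, hr, Fintype.prod_sum_type, Equiv.Perm.sign_sumCongr]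
    ring
  simp only [altPairing, coordF_ιMulti_single,
    Matrix.det_apply' (indicatorMatrix k (fun _ : Fin q => enc _) _), Finset.sum_mul_sum]
  simp only [Finset.mul_sum]
  rw [Finset.sum_comm]
  simp_rw [Finset.sum_comm (s := (Finset.univ : Finset (Equiv.Perm (Fin q ⊕ Fin q)))), key]
  simp [Fintype.card_perm, sq, mul_assoc]

lemma det_indicatorMatrix_comp_swap {ι α : Type*} [Fintype ι] [DecidableEq ι] [DecidableEq α]
    (enc u : ι → α) {x y : ι} (h : x ≠ y) :
    (indicatorMatrix k enc (u ∘ Equiv.swap x y)).det = -(indicatorMatrix k enc u).det := by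
  have := Matrix.det_permute' (Equiv.swap x y) (indicatorMatrix k enc u)
  rw [Equiv.Perm.sign_swap h] at this
  simpa [indicatorMatrix, Matrix.submatrix] using this

lemma det_indicatorMatrix_perm {ι : Type*} {α : Type*} [Fintype ι] [DecidableEq ι]
    [DecidableEq α] (enc : ι ≃ α) (π : Equiv.Perm ι) :
    (indicatorMatrix k enc (enc ∘ π)).det = ((Equiv.Perm.sign π : ℤ) : k) := by
  have := Matrix.det_permute' π (1 : Matrix ι ι k)
  rw [Matrix.det_one, mul_one] at this
  rw [← this]
  congr 1
  ext x y
  simp [indicatorMatrix, Matrix.one_apply]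

lemma altPairing_sum {n q : ℕ} {ι κ : Type*} [Fintype ι] [Fintype κ]
    (enc : Fin q ⊕ Fin q → Fin n)
    (f : ι → ExteriorAlgebra k (Fin n → k) →ₗ[k] k)
    (g : κ → ExteriorAlgebra k (Fin n → k) →ₗ[k] k) :
    altPairing k q enc (∑ x, f x) (∑ y, g y) =
      ∑ z : ι × κ, altPairing k q enc (f z.1) (g z.2) := by
  simp only [altPairing, LinearMap.sum_apply, Finset.sum_mul_sum]
  simp only [Finset.mul_sum]
  rw [Fintype.sum_prod_type, Finset.sum_comm]
  refine Finset.sum_congr rfl fun x _ => ?_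
  rw [Finset.sum_comm]

/-- Two forms `π_{ij}` and `π_{i'j'}` attached to the same nonempty `(B, C)` are orthogonal for
the antisymmetrized pairing. -/
lemma altPairing_piF [CharZero k] {n m c : ℕ} (h : 0 < m + c)
    (enc : Fin (2 + (m + c)) ⊕ Fin (2 + (m + c)) → Fin n)
    (α : Fin 4 → Fin n) (β : Fin m → Fin 2 → Fin n) (γ : Fin c → Fin n) (i j i' j' : Fin 4) :
    altPairing k (2 + (m + c)) enc (piF k m c α β γ i j) (piF k m c α β γ i' j') = 0 := by
  rw [piF, piF, altPairing_sum]
  simp only [altPairing_coordF, ← Finset.mul_sum]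
  refine mul_eq_zero_of_right _ ?_
  rcases Nat.eq_zero_or_pos m with rfl | hm
  · refine Finset.sum_eq_zero fun z _ => ?_
    let t : Fin (2 + (0 + c)) := Fin.natAdd 2 (Fin.natAdd 0 ⟨0, by omega⟩)
    refine Matrix.det_zero_of_column_eq (i := Sum.inl t) (j := Sum.inr t) (by simp) fun x => ?_
    simp only [indicatorMatrix, Matrix.of_apply, Sum.elim_inl, Sum.elim_inr, t, tupleP,
      Fin.append_right]
  · let l : Fin m := ⟨0, hm⟩
    let t : Fin (2 + (m + c)) := Fin.natAdd 2 (Fin.castAdd c l)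
    let g : (Fin m → Fin 2) × (Fin m → Fin 2) → (Fin m → Fin 2) × (Fin m → Fin 2) :=
      fun z => (Function.update z.1 l (z.2 l), Function.update z.2 l (z.1 l))
    have hg : Function.Involutive g := fun z => by simp [g]
    have tuple_update (a b : Fin 4) (ε : Fin m → Fin 2) (x : Fin 2) :
        tupleP m c α β γ a b (Function.update ε l x) =
          Function.update (tupleP m c α β γ a b ε) t (β l x) := by
      funext s
      induction s using Fin.addCases with
      | left s =>
        rw [Function.update_of_ne (by simp [t, Fin.ext_iff]; omega)]
        simp [tupleP]
      | right s =>
        induction s using Fin.addCases with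
        | left s =>
          rcases eq_or_ne s l with rfl | hs
          · simp [t, tupleP]
          · rw [Function.update_of_ne (by simpa [t, Fin.ext_iff] using hs)]
            simp [tupleP, hs]
        | right s =>
          rw [Function.update_of_ne (by simp [t, Fin.ext_iff]; omega)]
          simp [tupleP]
    have tuple_at (a b : Fin 4) (ε : Fin m → Fin 2) :
        tupleP m c α β γ a b ε t = β l (ε l) := by simp [t, tupleP]
    have elim_g (z : (Fin m → Fin 2) × (Fin m → Fin 2)) :
        Sum.elim (tupleP m c α β γ i j (g z).1) (tupleP m c α β γ i' j' (g z).2) =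
          Sum.elim (tupleP m c α β γ i j z.1) (tupleP m c α β γ i' j' z.2) ∘
            Equiv.swap (Sum.inl t) (Sum.inr t) := by
      funext s
      rcases s with s | s <;> rcases eq_or_ne s t with rfl | hs
      · simp [g, tuple_update, tuple_at]
      · rw [Function.comp_apply, Equiv.swap_apply_of_ne_of_ne (by simpa using hs) (by simp)]
        simp [g, tuple_update, hs]
      · simp [g, tuple_update, tuple_at]
      · rw [Function.comp_apply, Equiv.swap_apply_of_ne_of_ne (by simp) (by simpa using hs)]
        simp [g, tuple_update, hs]
    refine self_eq_neg.mp ?_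
    rw [← Finset.sum_neg_distrib]
    refine (Fintype.sum_equiv hg.toPerm _ _ fun z => ?_)
    change _ = -(indicatorMatrix k enc
      (Sum.elim (tupleP m c α β γ i j (g z).1) (tupleP m c α β γ i' j' (g z).2))).det
    rw [elim_g, det_indicatorMatrix_comp_swap _ _ (by simp), neg_neg]

lemma polarTrace_Pprime [CharZero k] {n m c : ℕ} (h : 0 < m + c)
    (enc : Fin (2 + (m + c)) ⊕ Fin (2 + (m + c)) → Fin n)
    (α : Fin 4 → Fin n) (β : Fin m → Fin 2 → Fin n) (γ : Fin c → Fin n) :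
    polarTrace k (2 + (m + c)) enc (fun ω => Pprime k m c α β γ ω.val) = 0 := by
  have hzero (i j i' j' : Fin 4) : polarTrace k (2 + (m + c)) enc
      (fun ω => piF k m c α β γ i j ω.val * piF k m c α β γ i' j' ω.val) = 0 := by
    rw [polarTrace_mul, altPairing_piF h, altPairing_piF h, add_zero]
  change polarTrace k (2 + (m + c)) enc
    ((fun ω => piF k m c α β γ 0 1 ω.val * piF k m c α β γ 2 3 ω.val) -
      (fun ω => piF k m c α β γ 0 2 ω.val * piF k m c α β γ 1 3 ω.val) +
      (fun ω => piF k m c α β γ 0 3 ω.val * piF k m c α β γ 1 2 ω.val)) = 0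
  rw [map_add, map_sub, hzero, hzero, hzero, sub_zero, add_zero]

lemma polarTrace_coordF_mul_of_perm {n q : ℕ} (enc : Fin q ⊕ Fin q ≃ Fin n)
    (i j : Fin q → Fin n) (π : Equiv.Perm (Fin n)) (h : Sum.elim i j = π ∘ enc) :
    polarTrace k q enc (fun ω => coordF k q i ω.val * coordF k q j ω.val) =
      (q.factorial : k) ^ 2 * (1 + (Equiv.Perm.sign (Equiv.sumComm (Fin q) (Fin q)) : ℤ)) *
        (Equiv.Perm.sign π : ℤ) := by
  have h₁ : Sum.elim i j = enc ∘ (enc.trans (π.trans enc.symm)) := by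
    rw [h]; funext x; simp
  have h₂ : Sum.elim j i =
      enc ∘ ((Equiv.sumComm (Fin q) (Fin q)).trans (enc.trans (π.trans enc.symm))) := by
    rw [Equiv.coe_trans, ← Function.comp_assoc, ← h₁]
    funext x; cases x <;> simp
  have hs : Equiv.Perm.sign (enc.trans (π.trans enc.symm)) = Equiv.Perm.sign π :=
    Equiv.Perm.sign_symm_trans_trans π enc.symm
  rw [polarTrace_mul, altPairing_coordF, altPairing_coordF, h₁, h₂, det_indicatorMatrix_perm,
    det_indicatorMatrix_perm, Equiv.Perm.sign_trans, hs]
  push_cast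
  ring

lemma sign_sumComm_four :
    Equiv.Perm.sign (Equiv.sumComm (Fin 4) (Fin 4)) = 1 := by
  have : Equiv.sumComm (Fin 4) (Fin 4) =
      Equiv.swap (Sum.inl 0) (Sum.inr 0) * Equiv.swap (Sum.inl 1) (Sum.inr 1) *
        Equiv.swap (Sum.inl 2) (Sum.inr 2) * Equiv.swap (Sum.inl 3) (Sum.inr 3) := by
    decide
  rw [this]
  simp

lemma polarTrace_Pluecker :
    polarTrace k 4 finSumFinEquiv
      (fun ω : ⋀[k]^4 (Fin 8 → k) =>
        Pluecker k 3 4 ![0, 1, 2] ![3, 4, 5, 6, 7] ω.val) = 5760 := by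
  have hterm (i : Fin 5) : polarTrace k 4 finSumFinEquiv
      (fun ω : ⋀[k]^4 (Fin 8 → k) =>
        coordF k 4 (Fin.snoc ![0, 1, 2] ((![3, 4, 5, 6, 7] : Fin 5 → Fin 8) i)) ω.val *
          coordF k 4 (fun j => (![3, 4, 5, 6, 7] : Fin 5 → Fin 8) (i.succAbove j)) ω.val) =
      1152 * (-1) ^ (i : ℕ) := by
    obtain ⟨π, hs, h⟩ : ∃ π : Equiv.Perm (Fin 8), Equiv.Perm.sign π = (-1) ^ (i : ℕ) ∧
        Sum.elim (Fin.snoc ![0, 1, 2] ((![3, 4, 5, 6, 7] : Fin 5 → Fin 8) i))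
          (fun j => (![3, 4, 5, 6, 7] : Fin 5 → Fin 8) (i.succAbove j)) =
            π ∘ (finSumFinEquiv : Fin 4 ⊕ Fin 4 ≃ Fin 8) := by
      fin_cases i
      · exact ⟨1, by simp, by decide⟩
      · exact ⟨Equiv.swap 3 4, by simp, by decide⟩
      · exact ⟨Equiv.swap 3 5 * Equiv.swap 4 5,
          by simp, by decide⟩
      · exact ⟨Equiv.swap 3 6 * Equiv.swap 4 6 * Equiv.swap 5 6,
          by simp; decide, by decide⟩
      · exact ⟨Equiv.swap 3 7 * Equiv.swap 4 7 * Equiv.swap 5 7 * Equiv.swap 6 7,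
          by simp; decide, by decide⟩
    refine (polarTrace_coordF_mul_of_perm finSumFinEquiv _ _ π h).trans ?_
    rw [sign_sumComm_four, hs]
    norm_num [Nat.factorial]
  have hsum : (fun ω : ⋀[k]^4 (Fin 8 → k) =>
        Pluecker k 3 4 ![0, 1, 2] ![3, 4, 5, 6, 7] ω.val) =
      ∑ i : Fin 5, (-1 : k) ^ (i : ℕ) • (fun ω : ⋀[k]^4 (Fin 8 → k) =>
        coordF k 4 (Fin.snoc ![0, 1, 2] ((![3, 4, 5, 6, 7] : Fin 5 → Fin 8) i)) ω.val *
          coordF k 4 (fun j => (![3, 4, 5, 6, 7] : Fin 5 → Fin 8) (i.succAbove j)) ω.val) := by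
    funext ω
    simp [Pluecker, Finset.sum_apply]
  rw [hsum, map_sum]
  simp only [map_smul, hterm]
  norm_num [Fin.sum_univ_succ]

end

/-- Over a field of characteristic zero, the Plücker relation
`P_{{1,2,3},{4,5,6,7,8}}` on `⋀⁴ k⁸` is not a `k`-linear combination of the rank 6
quadratic forms `P'_{A,B,C}`. -/
theorem pluecker_not_in_span_of_Pprime
    {k : Type*} [Field k] [CharZero k] :
    ¬ (fun ω : ⋀[k]^4 (Fin 8 → k) =>
          Pluecker k 3 4 ![0, 1, 2] ![3, 4, 5, 6, 7] ω.val) ∈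
        Submodule.span k
          {g : (⋀[k]^4 (Fin 8 → k)) → k |
            ∃ (m : ℕ) (_ : m ≤ 2) (α : Fin 4 → Fin 8) (β : Fin m → Fin 2 → Fin 8)
              (γ : Fin (2 - m) → Fin 8),
              Function.Injective α ∧ Function.Injective β ∧ Function.Injective γ ∧
                g = fun ω => Pprime k m (2 - m) α β γ ω.val} := by
  intro hmem
  have hle : Submodule.span k
      {g : (⋀[k]^4 (Fin 8 → k)) → k |
        ∃ (m : ℕ) (_ : m ≤ 2) (α : Fin 4 → Fin 8) (β : Fin m → Fin 2 → Fin 8)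
          (γ : Fin (2 - m) → Fin 8),
          Function.Injective α ∧ Function.Injective β ∧ Function.Injective γ ∧
            g = fun ω => Pprime k m (2 - m) α β γ ω.val} ≤
      LinearMap.ker (polarTrace k 4 finSumFinEquiv) := by
    refine Submodule.span_le.mpr ?_
    rintro _ ⟨m, hm, α, β, γ, -, -, -, rfl⟩
    change polarTrace k 4 finSumFinEquiv _ = 0
    interval_cases m
    · exact polarTrace_Pprime (m := 0) (c := 2) (by norm_num) finSumFinEquiv α β γ
    · exact polarTrace_Pprime (m := 1) (c := 1) (by norm_num) finSumFinEquiv α β γ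
    · exact polarTrace_Pprime (m := 2) (c := 0) (by norm_num) finSumFinEquiv α β γ
  have hker := LinearMap.mem_ker.mp (hle hmem)
  rw [polarTrace_Pluecker] at hker
  norm_num at hker

end
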